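/- arXiv:2311.18562 — 2 statements merged into one kernel-verified Lean document; each statement's English description precedes it below -/
import Mathlib

section
/- Let R ⊆ E_n be a parabolic type and S ⊆ E_n a subset with |S| ≥ 2. Then the following are equivalent: (i) 𝒞_{R,S} = 𝒞_{pHa,S}; (ii) 𝒞_{pHa,S} is a homogeneous S-adapted p-cone, i.e. there exists a single subset T ⊆ E_n with 𝒞_{pHa,S} = {x ∈ ℤ^n : F_T^{(i)}(x) ≤ 0 for all i ∈ S}; (iii) for every s ∈ S, letting γ(s) be the least integer g ≥ 1 with s+g ∈ S, the integers #{u : 0 ≤ u < γ(s), s+u ∈ R} and γ(s) have different parity. -/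
open scoped Pointwise

/-- The sign `δ_A^{(i)}`: `-1` if `i ∈ A`, `1` otherwise. -/
def sgn {n : ℕ} (A : Finset (ZMod n)) (i : ZMod n) : ℤ := if i ∈ A then -1 else 1

/-- The `p`-expression `F_T^{(d)}(x) = Σ_{i=0}^{n−1} p^i δ_T^{(d+i)} x_{d+i}`. -/
def pExpr (p : ℕ) {n : ℕ} (T : Finset (ZMod n)) (d : ZMod n) (x : ZMod n → ℤ) : ℤ :=
  ∑ i ∈ Finset.range n, (p : ℤ) ^ i * sgn T (d + (i : ZMod n)) * x (d + (i : ZMod n))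

/-- The `S`-adapted `p`-cone associated to `γ`. -/
def adapCone (p : ℕ) {n : ℕ} (S : Finset (ZMod n)) (γ : ZMod n → Finset (ZMod n)) :
    Set (ZMod n → ℤ) :=
  {x | ∀ i ∈ S, pExpr p (γ i) i x ≤ 0}

/-- The vector `ha_{R,S}^{(i)}`. -/
def haVec (p : ℕ) {n : ℕ} (R S : Finset (ZMod n)) (i : ZMod n) : ZMod n → ℤ :=
  (if i ∈ S then (1 : ℤ) else -1) • Pi.single i (1 : ℤ)
    - ((p : ℤ) * sgn R (i - 1)) • Pi.single (i - 1) (1 : ℤ)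

/-- Saturation of a subset of `ℤ^n`. -/
def satur {n : ℕ} (C : Set (ZMod n → ℤ)) : Set (ZMod n → ℤ) :=
  {x | ∃ m : ℕ, 1 ≤ m ∧ (m : ℤ) • x ∈ C}

/-- The cone of partial Hasse invariants `𝒞_{pHa,S}`. -/
def CpHa (p : ℕ) {n : ℕ} [NeZero n] (R S : Finset (ZMod n)) : Set (ZMod n → ℤ) :=
  satur {x | ∃ c : ZMod n → ℤ, (∀ i ∈ S, 0 ≤ c i) ∧ x = ∑ i, c i • haVec p R S i}

/-- The kernel `𝕂_{R,S}`. -/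
def haKer (p : ℕ) {n : ℕ} [NeZero n] (R S : Finset (ZMod n)) : Set (ZMod n → ℤ) :=
  satur {x | ∃ c : ZMod n → ℤ, (∀ i ∈ S, c i = 0) ∧ x = ∑ i, c i • haVec p R S i}

/-- `T` is admissible with respect to `R` and `S`. -/
def Admissible {n : ℕ} (R S T : Finset (ZMod n)) : Prop :=
  ∀ i : ZMod n, i + 1 ∉ S →
    if i ∈ R then (i ∈ T ↔ i + 1 ∈ T) else (i ∈ T ↔ i + 1 ∉ T)

/-- `T` is `i`-positive. -/
def IPositive {n : ℕ} (R T : Finset (ZMod n)) (i : ZMod n) : Prop :=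
  i - 1 ∈ T ↔ i - 1 ∈ R

/-- Every residue class has a next element in a nonempty set. -/
lemma exists_next_mem {n : ℕ} [NeZero n] {S : Finset (ZMod n)} (hS : S.Nonempty) (s : ZMod n) :
    ∃ g : ℕ, 1 ≤ g ∧ s + (g : ZMod n) ∈ S ∧
      ∀ u : ℕ, 1 ≤ u → u < g → s + (u : ZMod n) ∉ S := by
  classical
  obtain ⟨a, ha⟩ := hS
  have hex : ∃ g : ℕ, 1 ≤ g ∧ s + (g : ZMod n) ∈ S := by
    refine ⟨(a - s).val + n, ?_, ?_⟩
    · have := NeZero.pos n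
      omega
    · simpa using ha
  refine ⟨Nat.find hex, (Nat.find_spec hex).1, (Nat.find_spec hex).2, fun u hu hlt hmem => ?_⟩
  exact Nat.find_min hex hlt ⟨hu, hmem⟩

lemma sgn_eq_one_or {n : ℕ} (A : Finset (ZMod n)) (i : ZMod n) :
    sgn A i = 1 ∨ sgn A i = -1 := by
  unfold sgn; split_ifs <;> simp

lemma sgn_eq_one_iff {n : ℕ} {A : Finset (ZMod n)} {i : ZMod n} : sgn A i = 1 ↔ i ∉ A := by
  unfold sgn; split_ifs with h <;> simp [h]

lemma iPositive_iff_sgn {n : ℕ} {R T : Finset (ZMod n)} {i : ZMod n} :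
    IPositive R T i ↔ sgn R (i - 1) * sgn T (i - 1) = 1 := by
  unfold IPositive sgn
  by_cases h1 : i - 1 ∈ T <;> by_cases h2 : i - 1 ∈ R <;> simp [h1, h2]

lemma admissible_iff_sgn {n : ℕ} {R S T : Finset (ZMod n)} :
    Admissible R S T ↔ ∀ j, j ∉ S → sgn T j = -(sgn R (j - 1) * sgn T (j - 1)) := by
  have key : ∀ i : ZMod n, (if i ∈ R then (i ∈ T ↔ i + 1 ∈ T) else (i ∈ T ↔ i + 1 ∉ T)) ↔
      sgn T (i + 1) = -(sgn R i * sgn T i) := by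
    intro i
    unfold sgn
    by_cases h1 : i ∈ T <;> by_cases h2 : i ∈ R <;> by_cases h3 : i + 1 ∈ T <;> simp [h1, h2, h3]
  constructor
  · intro h j hj
    have := (key (j - 1)).1 (h (j - 1) (by simpa using hj))
    simpa using this
  · intro h i hi
    exact (key i).2 (by simpa using h (i + 1) hi)

/-- The sign of an admissible set at `s` is determined by the gap up to the next positive index. -/
lemma notMem_iff_parity {n : ℕ} {R S T : Finset (ZMod n)} (hT : Admissible R S T) :
    ∀ (g : ℕ), 1 ≤ g → ∀ s : ZMod n, IPositive R T (s + (g : ZMod n)) →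
      (∀ u : ℕ, 1 ≤ u → u < g → s + (u : ZMod n) ∉ S) →
      (s ∉ T ↔ ¬(((Finset.range g).filter (fun u : ℕ => s + (u : ZMod n) ∈ R)).card % 2
        = g % 2)) := by
  intro g hg
  induction g, hg using Nat.le_induction with
  | base =>
    intro s hpos _
    have h : s ∈ T ↔ s ∈ R := by simpa [IPositive] using hpos
    by_cases hR : s ∈ R <;> simp [h, hR, Finset.filter_singleton]
  | succ g hg ih =>
    intro s hpos hgap
    have e : ∀ u : ℕ, s + ((u + 1 : ℕ) : ZMod n) = s + 1 + (u : ZMod n) := by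
      intro u; push_cast; ring
    have h1 := ih (s + 1) (by rw [← e]; exact hpos)
      (fun u hu hlt => by rw [← e]; exact hgap (u + 1) (by omega) (by omega))
    have h2 := hT s (by simpa using hgap 1 le_rfl (by omega))
    rw [Finset.card_filter] at h1 ⊢
    rw [Finset.sum_range_succ']
    simp only [e, Nat.cast_zero, add_zero]
    by_cases hR : s ∈ R
    · simp only [hR, if_true] at h2 ⊢
      rw [h2, h1]
      omega
    · simp only [hR, if_false] at h2 ⊢
      rw [h2, not_not, ← not_iff_not, h1]
      omega

/-- An admissible set that is positive along a nonempty `S` is unique. -/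
lemma Admissible.eq_of_iPositive {n : ℕ} [NeZero n] {R S T T' : Finset (ZMod n)}
    (hS : S.Nonempty) (hT : Admissible R S T) (hT' : Admissible R S T')
    (hp : ∀ i ∈ S, IPositive R T i) (hp' : ∀ i ∈ S, IPositive R T' i) : T = T' := by
  ext s
  obtain ⟨g, hg, hmem, hgap⟩ := exists_next_mem hS s
  have h1 := notMem_iff_parity hT g hg s (hp _ hmem) hgap
  have h2 := notMem_iff_parity hT' g hg s (hp' _ hmem) hgap
  exact not_iff_not.1 (h1.trans h2.symm)

lemma pExpr_eq_sum (p : ℕ) {n : ℕ} [NeZero n] (T : Finset (ZMod n)) (d : ZMod n)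
    (x : ZMod n → ℤ) :
    pExpr p T d x = ∑ j, (p : ℤ) ^ (j - d).val * sgn T j * x j := by
  unfold pExpr
  refine Finset.sum_bij' (fun i _ => d + (i : ZMod n)) (fun j _ => (j - d).val) ?_ ?_ ?_ ?_ ?_
  · intros; exact Finset.mem_univ _
  · intro j _
    exact Finset.mem_range.2 (ZMod.val_lt _)
  · intro i hi
    simp [ZMod.val_natCast_of_lt (Finset.mem_range.1 hi)]
  · intro j _
    simp
  · intro i hi
    simp [ZMod.val_natCast_of_lt (Finset.mem_range.1 hi)]

lemma pExpr_smul (p : ℕ) {n : ℕ} (T : Finset (ZMod n)) (d : ZMod n) (m : ℤ)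
    (x : ZMod n → ℤ) : pExpr p T d (m • x) = m * pExpr p T d x := by
  unfold pExpr
  rw [Finset.mul_sum]
  refine Finset.sum_congr rfl fun i _ => ?_
  simp only [Pi.smul_apply, smul_eq_mul]
  ring

lemma pExpr_sum_smul (p : ℕ) {n : ℕ} [NeZero n] (T : Finset (ZMod n)) (d : ZMod n)
    (c : ZMod n → ℤ) (v : ZMod n → ZMod n → ℤ) :
    pExpr p T d (∑ i, c i • v i) = ∑ i, c i * pExpr p T d (v i) := by
  unfold pExpr
  simp only [Finset.sum_apply, Pi.smul_apply, smul_eq_mul, Finset.mul_sum]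
  rw [Finset.sum_comm]
  refine Finset.sum_congr rfl fun i _ => Finset.sum_congr rfl fun j _ => ?_
  ring

lemma pExpr_haVec (p : ℕ) {n : ℕ} [NeZero n] (R S T : Finset (ZMod n)) (d j : ZMod n) :
    pExpr p T d (haVec p R S j) =
      (p : ℤ) ^ (j - d).val * ((if j ∈ S then (1 : ℤ) else -1) * sgn T j) -
        (p : ℤ) ^ ((j - 1 - d).val + 1) * (sgn R (j - 1) * sgn T (j - 1)) := by
  rw [pExpr_eq_sum]
  simp only [haVec, Pi.sub_apply, Pi.smul_apply, smul_eq_mul, mul_sub, Finset.sum_sub_distrib,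
    Pi.single_apply, mul_ite, mul_one, mul_zero, Finset.sum_ite_eq',
    Finset.mem_univ, if_true]
  split_ifs <;> ring

lemma val_sub_one_sub_self {n : ℕ} [NeZero n] (d : ZMod n) : (d - 1 - d).val + 1 = n := by
  obtain ⟨m, rfl⟩ := Nat.exists_eq_succ_of_ne_zero (NeZero.ne n)
  rw [show d - 1 - d = -1 by ring, ZMod.val_neg_one]

lemma val_sub_one_sub {n : ℕ} [NeZero n] {d j : ZMod n} (h : j ≠ d) :
    (j - 1 - d).val + 1 = (j - d).val := by
  have h0 : j - d ≠ 0 := sub_ne_zero.2 h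
  have hv : (j - d).val ≠ 0 := fun h => h0 ((ZMod.val_eq_zero _).1 h)
  have hlt := ZMod.val_lt (j - d)
  have : j - 1 - d = (((j - d).val - 1 : ℕ) : ZMod n) := by
    rw [Nat.cast_sub (by omega)]
    simp only [ZMod.natCast_val, ZMod.cast_id', id_eq, Nat.cast_one]
    ring
  rw [this, ZMod.val_natCast_of_lt (by omega)]
  omega

lemma pExpr_haVec_self (p : ℕ) {n : ℕ} [NeZero n] (R : Finset (ZMod n)) {S : Finset (ZMod n)}
    (T : Finset (ZMod n)) {d : ZMod n} (hd : d ∈ S) :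
    pExpr p T d (haVec p R S d) =
      sgn T d - (p : ℤ) ^ n * (sgn R (d - 1) * sgn T (d - 1)) := by
  rw [pExpr_haVec, val_sub_one_sub_self]
  simp [hd]

lemma pExpr_haVec_of_ne (p : ℕ) {n : ℕ} [NeZero n] (R S T : Finset (ZMod n)) {d j : ZMod n}
    (h : j ≠ d) :
    pExpr p T d (haVec p R S j) =
      (p : ℤ) ^ (j - d).val * ((if j ∈ S then (1 : ℤ) else -1) * sgn T j -
        sgn R (j - 1) * sgn T (j - 1)) := by
  rw [pExpr_haVec, val_sub_one_sub h]
  ring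

lemma sum_haVec_apply (p : ℕ) {n : ℕ} [NeZero n] (R S : Finset (ZMod n)) (c : ZMod n → ℤ)
    (i : ZMod n) :
    (∑ j, c j • haVec p R S j) i =
      (if i ∈ S then (1 : ℤ) else -1) * c i - (p : ℤ) * sgn R i * c (i + 1) := by
  have e : ∀ j : ZMod n, (i = j - 1) = (i + 1 = j) := fun j => propext eq_sub_iff_add_eq
  simp only [haVec, Finset.sum_apply, Pi.sub_apply, Pi.smul_apply, smul_eq_mul, mul_sub,
    Finset.sum_sub_distrib, Pi.single_apply, e, mul_ite, mul_one, mul_zero, Finset.sum_ite_eq,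
    Finset.mem_univ, if_true, add_sub_cancel_right]
  split_ifs <;> ring

/-- The vectors `haVec p R S i` are linearly independent. -/
lemma eq_zero_of_sum_haVec_eq_zero {p : ℕ} (hp : 2 ≤ p) {n : ℕ} [NeZero n]
    {R S : Finset (ZMod n)} {c : ZMod n → ℤ} (h : ∑ j, c j • haVec p R S j = 0) : c = 0 := by
  have habs : ∀ i, |c i| = p * |c (i + 1)| := by
    intro i
    have h1 := congrFun h i
    rw [sum_haVec_apply, Pi.zero_apply, sub_eq_zero] at h1
    have h2 := congrArg abs h1
    rw [abs_mul, abs_mul, abs_mul] at h2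
    have h3 : |if i ∈ S then (1 : ℤ) else -1| = 1 := by split_ifs <;> simp
    have h4 : |sgn R i| = 1 := by rcases sgn_eq_one_or R i with h | h <;> simp [h]
    simpa [h3, h4] using h2
  have hsum : ∑ i, |c i| = p * ∑ i, |c i| := by
    conv_lhs => rw [Finset.sum_congr rfl fun i _ => habs i, ← Finset.mul_sum]
    exact congrArg _ (Equiv.sum_comp (Equiv.addRight (1 : ZMod n)) fun i => |c i|)
  have hp' : (2 : ℤ) ≤ p := by exact_mod_cast hp
  have h0 : 0 ≤ ∑ i, |c i| := Finset.sum_nonneg fun i _ => abs_nonneg _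
  have hz : ∑ i, |c i| = 0 := by nlinarith
  funext i
  exact abs_eq_zero.1 ((Finset.sum_eq_zero_iff_of_nonneg fun i _ => abs_nonneg (c i)).1 hz i
    (Finset.mem_univ i))

/-- The vectors `haVec p R S i` span `ℤ^n` up to finite index. -/
lemma exists_smul_eq_sum_haVec {p : ℕ} (hp : 2 ≤ p) {n : ℕ} [NeZero n] (R S : Finset (ZMod n))
    (x : ZMod n → ℤ) :
    ∃ m : ℕ, 1 ≤ m ∧ ∃ c : ZMod n → ℤ, (m : ℤ) • x = ∑ j, c j • haVec p R S j := by
  let M : Matrix (ZMod n) (ZMod n) ℤ := Matrix.of fun i j => haVec p R S j i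
  have hM : ∀ c, M.mulVec c = ∑ j, c j • haVec p R S j := by
    intro c
    funext i
    simp [M, Matrix.mulVec, dotProduct, mul_comm]
  have hdet : M.det ≠ 0 := by
    intro h
    obtain ⟨v, hv, hv0⟩ := Matrix.exists_mulVec_eq_zero_iff.2 h
    rw [hM] at hv0
    exact hv (eq_zero_of_sum_haVec_eq_zero hp hv0)
  refine ⟨M.det.natAbs, Nat.one_le_iff_ne_zero.2 (Int.natAbs_ne_zero.2 hdet),
    M.det.sign • M.adjugate.mulVec x, ?_⟩
  rw [← hM, Matrix.mulVec_smul, Matrix.mulVec_mulVec, Matrix.mul_adjugate, Matrix.smul_mulVec,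
    Matrix.one_mulVec, smul_smul, Int.sign_mul_self_eq_natAbs]

lemma haVec_mem_CpHa (p : ℕ) {n : ℕ} [NeZero n] (R S : Finset (ZMod n)) (j : ZMod n) :
    haVec p R S j ∈ CpHa p R S := by
  refine ⟨1, le_rfl, Pi.single j 1, fun i _ => ?_, ?_⟩
  · rw [Pi.single_apply]; split_ifs <;> norm_num
  · simp [Pi.single_apply, ite_smul]

lemma neg_haVec_mem_CpHa (p : ℕ) {n : ℕ} [NeZero n] (R : Finset (ZMod n)) {S : Finset (ZMod n)}
    {j : ZMod n} (hj : j ∉ S) : -haVec p R S j ∈ CpHa p R S := by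
  refine ⟨1, le_rfl, Pi.single j (-1), fun i hi => ?_, ?_⟩
  · rw [Pi.single_apply, if_neg (by rintro rfl; exact hj hi)]
  · simp [Pi.single_apply, ite_smul]

/-- A homogeneous `p`-cone containing the cone of partial Hasse invariants comes from an
admissible and positive set. -/
lemma admissible_and_iPositive_of_CpHa_subset {p : ℕ} (hp : 2 ≤ p) {n : ℕ} [NeZero n]
    {R S : Finset (ZMod n)} (hS : 2 ≤ S.card) {T : Finset (ZMod n)}
    (h : CpHa p R S ⊆ adapCone p S fun _ => T) :
    Admissible R S T ∧ ∀ i ∈ S, IPositive R T i := by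
  have hp' : (2 : ℤ) ≤ p := by exact_mod_cast hp
  constructor
  · rw [admissible_iff_sgn]
    intro j hj
    obtain ⟨i, hi⟩ := Finset.card_pos.1 (by omega : 0 < S.card)
    have hne : j ≠ i := by rintro rfl; exact hj hi
    have h1 := h (haVec_mem_CpHa p R S j) i hi
    have h2 := h (neg_haVec_mem_CpHa p R hj) i hi
    rw [← neg_one_zsmul, pExpr_smul] at h2
    have h3 : pExpr p T i (haVec p R S j) = 0 := by linarith
    rw [pExpr_haVec_of_ne p R S T hne, if_neg hj, mul_eq_zero] at h3
    rcases h3 with h3 | h3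
    · exact absurd h3 (pow_ne_zero _ (by omega))
    · linarith
  · intro i hi
    have h1 : pExpr p T i (haVec p R S i) ≤ 0 := h (haVec_mem_CpHa p R S i) i hi
    rw [pExpr_haVec_self p R T hi] at h1
    rw [iPositive_iff_sgn]
    have hpn : (1 : ℤ) < (p : ℤ) ^ n := one_lt_pow₀ (by omega) (NeZero.ne n)
    rcases sgn_eq_one_or T i with ht | ht <;>
    rcases sgn_eq_one_or R (i - 1) with hr | hr <;>
    rcases sgn_eq_one_or T (i - 1) with ht' | ht' <;>
    simp only [ht, hr, ht'] at h1 ⊢ <;> first | (exfalso; linarith) | norm_num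

section Positive

variable {p : ℕ} {n : ℕ} [NeZero n] {R S T : Finset (ZMod n)}

lemma pExpr_haVec_eq_zero (hT : Admissible R S T) {d j : ZMod n} (hd : d ∈ S) (hj : j ∉ S) :
    pExpr p T d (haVec p R S j) = 0 := by
  have hne : j ≠ d := by rintro rfl; exact hj hd
  rw [pExpr_haVec_of_ne p R S T hne, if_neg hj, admissible_iff_sgn.1 hT j hj]
  ring

lemma pExpr_haVec_of_iPositive (hpos : ∀ i ∈ S, IPositive R T i) {d j : ZMod n} (hj : j ∈ S)
    (hne : j ≠ d) :
    pExpr p T d (haVec p R S j) = (p : ℤ) ^ (j - d).val * (sgn T j - 1) := by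
  rw [pExpr_haVec_of_ne p R S T hne, if_pos hj, iPositive_iff_sgn.1 (hpos j hj), one_mul]

lemma pExpr_haVec_self_of_iPositive (hpos : ∀ i ∈ S, IPositive R T i) {d : ZMod n}
    (hd : d ∈ S) : pExpr p T d (haVec p R S d) = sgn T d - (p : ℤ) ^ n := by
  rw [pExpr_haVec_self p R T hd, iPositive_iff_sgn.1 (hpos d hd), mul_one]

lemma CpHa_subset_adapCone (hp : 2 ≤ p) (hT : Admissible R S T)
    (hpos : ∀ i ∈ S, IPositive R T i) : CpHa p R S ⊆ adapCone p S fun _ => T := by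
  rintro x ⟨m, hm, c, hc, hx⟩ i hi
  have hp' : (2 : ℤ) ≤ p := by exact_mod_cast hp
  have hpn : (1 : ℤ) < (p : ℤ) ^ n := one_lt_pow₀ (by omega) (NeZero.ne n)
  have hF : ∀ j, c j * pExpr p T i (haVec p R S j) ≤ 0 := by
    intro j
    by_cases hj : j ∈ S
    · refine mul_nonpos_of_nonneg_of_nonpos (hc j hj) ?_
      have hle : sgn T j ≤ 1 := by rcases sgn_eq_one_or T j with h | h <;> simp [h]
      by_cases hne : j = i
      · subst hne
        rw [pExpr_haVec_self_of_iPositive hpos hj]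
        linarith
      · rw [pExpr_haVec_of_iPositive hpos hj hne]
        exact mul_nonpos_of_nonneg_of_nonpos (by positivity) (by linarith)
    · rw [pExpr_haVec_eq_zero hT hi hj, mul_zero]
  have h1 : (m : ℤ) * pExpr p T i x ≤ 0 := by
    rw [← pExpr_smul, hx, pExpr_sum_smul]
    exact Finset.sum_nonpos fun j _ => hF j
  have hm' : (0 : ℤ) < m := by exact_mod_cast hm
  exact nonpos_of_mul_nonpos_right h1 hm'

lemma adapCone_subset_CpHa (hp : 2 ≤ p) (hT : Admissible R S T)
    (hpos : ∀ i ∈ S, IPositive R T i) (hone : ∀ s ∈ S, s ∉ T) :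
    (adapCone p S fun _ => T) ⊆ CpHa p R S := by
  intro x hx
  have hp' : (2 : ℤ) ≤ p := by exact_mod_cast hp
  have hpn : (1 : ℤ) < (p : ℤ) ^ n := one_lt_pow₀ (by omega) (NeZero.ne n)
  obtain ⟨m, hm, c, hc⟩ := exists_smul_eq_sum_haVec hp R S x
  refine ⟨m, hm, c, fun s hs => ?_, hc⟩
  have h1 : (m : ℤ) * pExpr p T s x = c s * (1 - (p : ℤ) ^ n) := by
    rw [← pExpr_smul, hc, pExpr_sum_smul, Finset.sum_eq_single s]
    · rw [pExpr_haVec_self_of_iPositive hpos hs, sgn_eq_one_iff.2 (hone s hs)]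
    · intro j _ hne
      by_cases hj : j ∈ S
      · rw [pExpr_haVec_of_iPositive hpos hj hne, sgn_eq_one_iff.2 (hone j hj)]
        ring
      · rw [pExpr_haVec_eq_zero hT hs hj, mul_zero]
    · intro h
      exact absurd (Finset.mem_univ s) h
  have h2 : (m : ℤ) * pExpr p T s x ≤ 0 :=
    mul_nonpos_of_nonneg_of_nonpos (by positivity) (hx s hs)
  nlinarith

lemma notMem_of_adapCone_subset_CpHa (hp : 2 ≤ p) (hS : 2 ≤ S.card)
    (hpos : ∀ i ∈ S, IPositive R T i) (h : (adapCone p S fun _ => T) ⊆ CpHa p R S) :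
    ∀ s ∈ S, s ∉ T := by
  intro j hj hjT
  have hp' : (2 : ℤ) ≤ p := by exact_mod_cast hp
  have hpn : (1 : ℤ) < (p : ℤ) ^ n := one_lt_pow₀ (by omega) (NeZero.ne n)
  obtain ⟨i, hi, hij⟩ := Finset.exists_mem_ne (by omega : 1 < S.card) j
  have hsj : sgn T j = -1 := by simp [sgn, hjT]
  have hsum : ∑ k, (Pi.single j (2 * (p : ℤ) ^ n) - Pi.single i 1 : ZMod n → ℤ) k •
      haVec p R S k = (2 * (p : ℤ) ^ n) • haVec p R S j - haVec p R S i := by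
    simp [Pi.single_apply, sub_smul, ite_smul, Finset.sum_sub_distrib]
  have hmem : (∑ k, (Pi.single j (2 * (p : ℤ) ^ n) - Pi.single i 1 : ZMod n → ℤ) k •
      haVec p R S k) ∈ adapCone p S fun _ => T := by
    intro k hk
    have hval : pExpr p T k (∑ l, (Pi.single j (2 * (p : ℤ) ^ n) - Pi.single i 1 :
        ZMod n → ℤ) l • haVec p R S l) =
        2 * (p : ℤ) ^ n * pExpr p T k (haVec p R S j) - pExpr p T k (haVec p R S i) := by
      rw [pExpr_sum_smul]
      simp [Pi.single_apply, sub_mul, ite_mul, Finset.sum_sub_distrib]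
    have hjneg : pExpr p T k (haVec p R S j) ≤ -1 := by
      by_cases hjk : j = k
      · subst hjk
        rw [pExpr_haVec_self_of_iPositive hpos hj]
        linarith
      · rw [pExpr_haVec_of_iPositive hpos hj hjk, hsj]
        have : (0 : ℤ) < (p : ℤ) ^ (j - k).val := by positivity
        linarith
    have hiub : -(2 * (p : ℤ) ^ n) ≤ pExpr p T k (haVec p R S i) := by
      have hle : -1 ≤ sgn T i := by rcases sgn_eq_one_or T i with h | h <;> simp [h]
      by_cases hik : i = k
      · subst hik
        rw [pExpr_haVec_self_of_iPositive hpos hi]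
        linarith
      · rw [pExpr_haVec_of_iPositive hpos hi hik]
        have h1 : (p : ℤ) ^ (i - k).val ≤ (p : ℤ) ^ n :=
          pow_le_pow_right₀ (by omega) (ZMod.val_lt _).le
        have h2 : (0 : ℤ) < (p : ℤ) ^ (i - k).val := by positivity
        nlinarith
    change pExpr p T k _ ≤ 0
    rw [hval]
    nlinarith
  obtain ⟨m, hm, c, hc, hx⟩ := h hmem
  have hm' : (0 : ℤ) < m := by exact_mod_cast hm
  have hz : ∑ k, (c - (m : ℤ) • (Pi.single j (2 * (p : ℤ) ^ n) - Pi.single i 1 :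
      ZMod n → ℤ)) k • haVec p R S k = 0 := by
    simp only [Pi.sub_apply c, sub_smul, Finset.sum_sub_distrib, ← hx, Pi.smul_apply (m : ℤ),
      smul_assoc, ← Finset.smul_sum, sub_self]
  have h0 := congrFun (eq_zero_of_sum_haVec_eq_zero hp hz) i
  have h1 := hc i hi
  simp [hij] at h0
  linarith

end Positive


/-- Theorem 5.10 (Hasse-regularity): for `|S| ≥ 2` and `T = Φ_R(S)`, the following are
equivalent: (i) `𝒞_{R,S} = 𝒞_{pHa,S}`; (ii) `𝒞_{pHa,S}` is a homogeneous `S`-adapted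
`p`-cone; (iii) for every `s ∈ S`, with `γ(s)` the least `g ≥ 1` such that `s + g ∈ S`, the
numbers `#{0 ≤ u < γ(s) : s+u ∈ R}` and `γ(s)` have different parity. -/
theorem hasse_regular_iff (p : ℕ) (hp : p.Prime) {n : ℕ} [NeZero n]
    (R S : Finset (ZMod n)) (hS : 2 ≤ S.card)
    (T : Finset (ZMod n)) (hTadm : Admissible R S T) (hTpos : ∀ i ∈ S, IPositive R T i) :
    ((adapCone p S (fun _ => T) = CpHa p R S) ↔
      ∃ T' : Finset (ZMod n), CpHa p R S = adapCone p S (fun _ => T')) ∧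
    ((adapCone p S (fun _ => T) = CpHa p R S) ↔
      ∀ s ∈ S, ∀ g : ℕ, 1 ≤ g → (s + (g : ZMod n)) ∈ S →
        (∀ u : ℕ, 1 ≤ u → u < g → (s + (u : ZMod n)) ∉ S) →
        ¬(((Finset.range g).filter (fun u : ℕ => (s + (u : ZMod n)) ∈ R)).card % 2
            = g % 2)) := by
  have hp2 := hp.two_le
  have hne : S.Nonempty := Finset.card_pos.1 (by omega)
  have hsub := CpHa_subset_adapCone hp2 hTadm hTpos
  constructor
  · refine ⟨fun h => ⟨T, h.symm⟩, ?_⟩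
    rintro ⟨T', h⟩
    obtain ⟨hadm, hpos⟩ := admissible_and_iPositive_of_CpHa_subset hp2 hS h.subset
    rw [h, hTadm.eq_of_iPositive hne hadm hTpos hpos]
  · have hiff : (adapCone p S fun _ => T) = CpHa p R S ↔ ∀ s ∈ S, s ∉ T :=
      ⟨fun h => notMem_of_adapCone_subset_CpHa hp2 hS hTpos h.subset,
        fun h => (adapCone_subset_CpHa hp2 hTadm hTpos h).antisymm hsub⟩
    rw [hiff]
    constructor
    · intro h s hs g hg hmem hgap
      exact (notMem_iff_parity hTadm g hg s (hTpos _ hmem) hgap).1 (h s hs)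
    · intro h s hs
      obtain ⟨g, hg, hmem, hgap⟩ := exists_next_mem hne s
      exact (notMem_iff_parity hTadm g hg s (hTpos _ hmem) hgap).2 (h s hs g hg hmem hgap)
end

section
/- Let R ⊊ E_n be a proper subset and write E_n ∖ R = {r_1, …, r_h} with h = n − |R|, numbered so that r_{i+1} is the element of E_n ∖ R following r_i (subscripts of r read modulo h, so r_0 = r_h and r_{h+1} = r_1). For 1 ≤ i ≤ h let g_i ≥ 1 be the least positive integer with r_{i−1} + g_i ≡ r_i (mod n), and define λ_k^{(i)} = e_{r_i} + p^k e_{r_i − k} for 1 ≤ k ≤ g_i − 1 and λ_{g_i}^{(i)} = e_{r_i} − p^{g_i} e_{r_{i−1}}. Then the n = Σ_{i=1}^h g_i vectors λ_k^{(i)} (1 ≤ i ≤ h, 1 ≤ k ≤ g_i) form a basis of ℚ^n. -/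
open scoped Pointwise

/-- The vector `λ_k^{(i)}` over `ℚ`: `e_{r_i} + p^k e_{r_i−k}` for `1 ≤ k < g_i`, and
`e_{r_i} − p^{g_i} e_{r_{i−1}}` for `k = g_i`. -/
def lamVecQ (p : ℕ) {n h : ℕ} [NeZero h] (rr : Fin h → ZMod n) (g : Fin h → ℕ)
    (i : Fin h) (k : ℕ) : ZMod n → ℚ :=
  if k = g i then
    Pi.single (rr i) (1 : ℚ) - (p : ℚ) ^ (g i) • (Pi.single (rr (i - 1)) (1 : ℚ) : ZMod n → ℚ)
  else
    Pi.single (rr i) (1 : ℚ) + (p : ℚ) ^ k • (Pi.single (rr i - (k : ZMod n)) (1 : ℚ) : ZMod n → ℚ)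

section LamVecBasis

variable {n h : ℕ} [NeZero h] {rr : Fin h → ZMod n} {g : Fin h → ℕ}

/-- Every residue is reached from some `rr i` by fewer than `g i` backward steps. -/
lemma exists_eq_sub_natCast [NeZero n] (hg1 : ∀ i, 1 ≤ g i)
    (hgap : ∀ i : Fin h, rr (i - 1) + (g i : ZMod n) = rr i) (x : ZMod n) :
    ∃ i : Fin h, ∃ k : ℕ, k < g i ∧ x = rr i - (k : ZMod n) := by
  classical
  have hex : ∃ m : ℕ, ∃ i, x + (m : ZMod n) = rr i :=
    ⟨(rr 0 - x).val, 0, by rw [ZMod.natCast_zmod_val]; ring⟩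
  obtain ⟨i, hi⟩ := Nat.find_spec hex
  refine ⟨i, Nat.find hex, ?_, by rw [← hi]; ring⟩
  by_contra! hle
  refine Nat.find_min hex (m := Nat.find hex - g i) (by have := hg1 i; omega) ⟨i - 1, ?_⟩
  rw [Nat.cast_sub hle, eq_sub_of_add_eq (hgap i), ← hi]
  ring

/-- Representations of residues by short backward steps from the `rr i` are unique. -/
lemma injective_sub_natCast [NeZero n] {R : Finset (ZMod n)} (hinj : Function.Injective rr)
    (hrr : Finset.image rr Finset.univ = Rᶜ)
    (hgap : ∀ i : Fin h, rr (i - 1) + (g i : ZMod n) = rr i)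
    (hfollow : ∀ i : Fin h, ∀ u : ℕ, 1 ≤ u → u < g i → rr (i - 1) + (u : ZMod n) ∈ R) :
    Function.Injective
      (fun ik : Σ i : Fin h, Fin (g i) => rr ik.1 - ((ik.2 : ℕ) : ZMod n)) := by
  have key : ∀ (i j : Fin h) (k l : ℕ), l < g j → k ≤ l →
      rr i - (k : ZMod n) = rr j - (l : ZMod n) → k = l := by
    intro i j k l hl hkl heq
    by_contra hne
    have hmem := hfollow j (g j - (l - k)) (by omega) (by omega)
    have hi : rr (j - 1) + ((g j - (l - k) : ℕ) : ZMod n) = rr i := by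
      rw [Nat.cast_sub (by omega), Nat.cast_sub hkl, eq_sub_of_add_eq (hgap j),
        eq_add_of_sub_eq heq]
      ring
    rw [hi] at hmem
    exact Finset.mem_compl.1 (hrr ▸ Finset.mem_image_of_mem rr (Finset.mem_univ i)) hmem
  rintro ⟨i, k, hk⟩ ⟨j, l, hl⟩ heq
  simp only at heq
  obtain rfl : k = l := by
    rcases le_total k l with hkl | hkl
    · exact key i j k l hl hkl heq
    · exact (key j i l k hk hkl heq.symm).symm
  obtain rfl : i = j := hinj (sub_left_injective heq)
  rfl

variable {p : ℕ} {W : Submodule ℚ (ZMod n → ℚ)}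

/-- A subspace containing all the `λ_{g i}^{(i)}` contains the basis vectors at the `rr i`. -/
lemma single_mem_of_lamVecQ_mem (hp : p.Prime)
    (hW : ∀ i, lamVecQ p rr g i (g i) ∈ W) (hg1 : ∀ i, 1 ≤ g i) (i : Fin h) :
    (Pi.single (rr i) (1 : ℚ) : ZMod n → ℚ) ∈ W := by
  have step : ∀ (t : ℕ) (i : Fin h), ∃ G : ℕ, t ≤ G ∧
      (Pi.single (rr i) (1 : ℚ) : ZMod n → ℚ)
        - (p : ℚ) ^ G • Pi.single (rr ((fun j => j - 1)^[t] i)) (1 : ℚ) ∈ W := by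
    intro t
    induction t with
    | zero => exact fun i => ⟨0, le_rfl, by simp⟩
    | succ t ih =>
      intro i
      obtain ⟨G, hG, hmem⟩ := ih (i - 1)
      refine ⟨g i + G, by have := hg1 i; omega, ?_⟩
      have hi := hW i
      rw [lamVecQ, if_pos rfl] at hi
      convert W.add_mem hi (W.smul_mem ((p : ℚ) ^ g i) hmem) using 1
      rw [Function.iterate_succ_apply, smul_sub, smul_smul, pow_add]
      abel
  obtain ⟨t, ht, hper⟩ := Function.Injective.mem_periodicPts
    (f := fun j : Fin h => j - 1) sub_left_injective i
  obtain ⟨G, hG, hmem⟩ := step t i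
  rw [hper.eq] at hmem
  have hne : (1 : ℚ) - (p : ℚ) ^ G ≠ 0 := by
    have : (1 : ℚ) < (p : ℚ) ^ G :=
      one_lt_pow₀ (by exact_mod_cast hp.one_lt) (by omega)
    linarith
  refine (W.smul_mem_iff hne).1 ?_
  rwa [sub_smul, one_smul]

/-- The vectors `λ_k^{(i)}` span. -/
lemma span_lamVecQ_eq_top [NeZero n] (hp : p.Prime)
    (hg1 : ∀ i, 1 ≤ g i) (hgap : ∀ i : Fin h, rr (i - 1) + (g i : ZMod n) = rr i) :
    Submodule.span ℚ
      (Set.range fun ik : Σ i : Fin h, Fin (g i) => lamVecQ p rr g ik.1 ((ik.2 : ℕ) + 1)) =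
      ⊤ := by
  set W := Submodule.span ℚ
    (Set.range fun ik : Σ i : Fin h, Fin (g i) => lamVecQ p rr g ik.1 ((ik.2 : ℕ) + 1))
  have hW : ∀ (i : Fin h) (k : ℕ), 1 ≤ k → k ≤ g i → lamVecQ p rr g i k ∈ W := by
    intro i k hk hkg
    refine Submodule.subset_span ⟨⟨i, k - 1, by omega⟩, ?_⟩
    simp only [Nat.sub_add_cancel hk]
  have hr := single_mem_of_lamVecQ_mem hp (fun i => hW i (g i) (hg1 i) le_rfl) hg1
  have hall : ∀ x : ZMod n, (Pi.single x (1 : ℚ) : ZMod n → ℚ) ∈ W := by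
    intro x
    obtain ⟨i, k, hk, rfl⟩ := exists_eq_sub_natCast hg1 hgap x
    rcases Nat.eq_zero_or_pos k with rfl | hk0
    · simpa using hr i
    have hmem := hW i k hk0 hk.le
    rw [lamVecQ, if_neg hk.ne, W.add_mem_iff_right (hr i)] at hmem
    exact (W.smul_mem_iff (pow_ne_zero k (by exact_mod_cast hp.ne_zero))).1 hmem
  rw [eq_top_iff, ← (Pi.basisFun ℚ (ZMod n)).span_eq, Submodule.span_le]
  rintro _ ⟨x, rfl⟩
  simpa using hall x

end LamVecBasis

/-- Lemma 5.14: the `n = Σ_{i=1}^h g_i` vectors `λ_k^{(i)}` (`1 ≤ i ≤ h`, `1 ≤ k ≤ g_i`)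
form a basis of `ℚ^n`: they are linearly independent and span. Here `r_1, …, r_h`
enumerates `E_n ∖ R` so that `r_i` is the element of `E_n ∖ R` following `r_{i−1}`
(subscripts mod `h`), and `g_i ≥ 1` is minimal with `r_{i−1} + g_i ≡ r_i (mod n)`.
The pair `⟨i, k⟩` with `k : Fin (g i)` encodes the vector `λ_{k+1}^{(i)}`. -/
theorem lamVec_basis (p : ℕ) (hp : p.Prime) {n : ℕ} [NeZero n]
    (R : Finset (ZMod n)) (hR : R ≠ Finset.univ)
    (h : ℕ) [NeZero h] (hh : h = n - R.card)
    (rr : Fin h → ZMod n) (hrr : Finset.image rr Finset.univ = Rᶜ)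
    (g : Fin h → ℕ) (hg1 : ∀ i, 1 ≤ g i)
    (hgap : ∀ i : Fin h, rr (i - 1) + (g i : ZMod n) = rr i)
    (hleast : ∀ i : Fin h, ∀ u : ℕ, 1 ≤ u → u < g i → rr (i - 1) + (u : ZMod n) ≠ rr i)
    (hfollow : ∀ i : Fin h, ∀ u : ℕ, 1 ≤ u → u < g i → rr (i - 1) + (u : ZMod n) ∈ R) :
    LinearIndependent ℚ
      (fun ik : Σ i : Fin h, Fin (g i) => lamVecQ p rr g ik.1 ((ik.2 : ℕ) + 1)) ∧
    Submodule.span ℚ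
      (Set.range fun ik : Σ i : Fin h, Fin (g i) => lamVecQ p rr g ik.1 ((ik.2 : ℕ) + 1)) =
      ⊤ := by
  have hspan := span_lamVecQ_eq_top hp hg1 hgap
  have hinj : Function.Injective rr := by
    rw [← Set.injOn_univ, ← Finset.coe_univ, ← Finset.card_image_iff, hrr, Finset.card_compl,
      ZMod.card, Finset.card_univ, Fintype.card_fin, hh]
  refine ⟨linearIndependent_of_top_le_span_of_card_eq_finrank hspan.ge ?_, hspan⟩
  rw [Module.finrank_fintype_fun_eq_card]
  refine Fintype.card_of_bijective ⟨injective_sub_natCast hinj hrr hgap hfollow, fun x => ?_⟩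
  obtain ⟨i, k, hk, rfl⟩ := exists_eq_sub_natCast hg1 hgap x
  exact ⟨⟨i, k, hk⟩, rfl⟩
end
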